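/- Let R be a commutative ring, S a commutative R-algebra, I an ideal of S with divided power structure hI : DividedPowers I, M an S-module equipped with a DP-module family φ, and let D be the induced divided power structure on the ideal 𝕀 = {(s,x) : s ∈ I} of TrivSqZeroExt S M given by D n (s,x) = (hI.dpow n s, φ n x + ∑_{i=1}^{n-1} (hI.dpow i s) • φ (n-i) x). Let d : S → M be an R-linear map and let σ : S → TrivSqZeroExt S M be given by σ(a) = (a, d a). Then σ is a ring homomorphism satisfying σ (hI.dpow n a) = D n (σ a) for all a ∈ I and n ≥ 1 if and only if d satisfies the Leibniz rule d(ab) = a • d b + b • d a for all a, b ∈ S and the compatibility d (hI.dpow n a) = φ n (d a) + ∑_{i=1}^{n-1} (hI.dpow i a) • φ (n-i) (d a) for all a ∈ I and n ≥ 1. -/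

import Mathlib

/-- A divided power module family on an `S`-module `M`: a family of additive maps
`phi n : M →+ M` (`n ≥ 1`) with `phi 1 = id`, `phi n (s • x) = s ^ n • phi n x`,
`((m+n).choose m) • phi (m+n) x = 0` and
`phi m (phi n x) = (Nat.uniformBell m n) • phi (m*n) x`. -/
structure DPModuleFamily (S : Type*) [CommRing S] (M : Type*) [AddCommGroup M]
    [Module S M] where
  phi : ℕ → M →+ M
  phi_one : phi 1 = AddMonoidHom.id M
  phi_smul : ∀ n : ℕ, 1 ≤ n → ∀ (s : S) (x : M), phi n (s • x) = s ^ n • phi n x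
  choose_smul_phi : ∀ m n : ℕ, 1 ≤ m → 1 ≤ n → ∀ x : M,
    ((m + n).choose m) • phi (m + n) x = 0
  phi_comp : ∀ m n : ℕ, 1 ≤ m → 1 ≤ n → ∀ x : M,
    phi m (phi n x) = (Nat.uniformBell m n) • phi (m * n) x

/-- The ideal `{(s, x) : s ∈ I, x ∈ M}` of the trivial square-zero extension. -/
def TrivSqZeroExt.dpIdeal (S : Type*) [CommRing S] (M : Type*) [AddCommGroup M]
    [Module S M] [Module Sᵐᵒᵖ M] [IsCentralScalar S M] (I : Ideal S) :
    Ideal (TrivSqZeroExt S M) where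
  carrier := {z | z.fst ∈ I}
  add_mem' := by
    intro z w hz hw
    simp only [Set.mem_setOf_eq, TrivSqZeroExt.fst_add] at *
    exact I.add_mem hz hw
  zero_mem' := by simpa using I.zero_mem
  smul_mem' := by
    intro c z hz
    simpa [smul_eq_mul, TrivSqZeroExt.fst_mul] using I.mul_mem_left c.fst hz

/-- the map `σ : a ↦ (a, d a)` is a ring homomorphism compatible with the
divided power structures if and only if `d` satisfies the Leibniz rule and the divided
power compatibility. -/
theorem section_isDPRingHom_iff {R : Type*} [CommRing R] {S : Type*} [CommRing S]
    [Algebra R S] {M : Type*} [AddCommGroup M] [Module S M] [Module Sᵐᵒᵖ M]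
    [IsCentralScalar S M] [Module R M] [IsScalarTower R S M]
    {I : Ideal S} (hI : DividedPowers I) (φ : DPModuleFamily S M)
    (D : ℕ → TrivSqZeroExt S M → TrivSqZeroExt S M)
    (hD_null : ∀ (n : ℕ) (z : TrivSqZeroExt S M),
      z ∉ TrivSqZeroExt.dpIdeal S M I → D n z = 0)
    (hD_zero : ∀ z ∈ TrivSqZeroExt.dpIdeal S M I, D 0 z = 1)
    (hD_pos : ∀ n : ℕ, 1 ≤ n → ∀ z ∈ TrivSqZeroExt.dpIdeal S M I,
      D n z = TrivSqZeroExt.inl (hI.dpow n z.fst) +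
        TrivSqZeroExt.inr (φ.phi n z.snd +
          ∑ i ∈ Finset.Ico 1 n, hI.dpow i z.fst • φ.phi (n - i) z.snd))
    (d : S →ₗ[R] M) :
    (∃ σ : S →+* TrivSqZeroExt S M,
      (∀ a : S, σ a = TrivSqZeroExt.inl a + TrivSqZeroExt.inr (d a)) ∧
      (∀ a ∈ I, ∀ n : ℕ, 1 ≤ n → σ (hI.dpow n a) = D n (σ a))) ↔
    ((∀ a b : S, d (a * b) = a • d b + b • d a) ∧
      (∀ a ∈ I, ∀ n : ℕ, 1 ≤ n →
        d (hI.dpow n a) = φ.phi n (d a) +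
          ∑ i ∈ Finset.Ico 1 n, hI.dpow i a • φ.phi (n - i) (d a))) := by
  have hD_section : ∀ a ∈ I, ∀ n : ℕ, 1 ≤ n →
      D n (TrivSqZeroExt.inl a + TrivSqZeroExt.inr (d a)) =
        TrivSqZeroExt.inl (hI.dpow n a) + TrivSqZeroExt.inr (φ.phi n (d a) +
          ∑ i ∈ Finset.Ico 1 n, hI.dpow i a • φ.phi (n - i) (d a)) := by
    intro a ha n hn
    have hmem : TrivSqZeroExt.inl a + TrivSqZeroExt.inr (d a) ∈
        TrivSqZeroExt.dpIdeal S M I := by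
      change (TrivSqZeroExt.inl a + TrivSqZeroExt.inr (d a)).fst ∈ I
      simpa using ha
    simpa using hD_pos n hn _ hmem
  constructor
  · rintro ⟨σ, hσ, hσD⟩
    refine ⟨fun a b => ?_, fun a ha n hn => ?_⟩
    · simpa [hσ] using congrArg TrivSqZeroExt.snd (map_mul σ a b)
    · have h := hσD a ha n hn
      rw [hσ, hσ, hD_section a ha n hn] at h
      exact TrivSqZeroExt.inr_injective (add_left_cancel h)
  · rintro ⟨hmul, hdpow⟩
    have hone : d 1 = 0 := by simpa using hmul 1 1
    refine ⟨{ toFun := fun a => TrivSqZeroExt.inl a + TrivSqZeroExt.inr (d a)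
              map_one' := by simp [hone]
              map_mul' := fun a b => by ext <;> simp [hmul]
              map_zero' := by simp
              map_add' := fun a b => by ext <;> simp },
      fun _ => rfl, fun a ha n hn => ?_⟩
    change TrivSqZeroExt.inl (hI.dpow n a) + TrivSqZeroExt.inr (d (hI.dpow n a)) =
      D n (TrivSqZeroExt.inl a + TrivSqZeroExt.inr (d a))
    rw [hD_section a ha n hn, hdpow a ha n hn]
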